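/- arXiv:2311.07641 — 4 statements merged into one kernel-verified Lean document; each statement's English description precedes it below -/
import Mathlib

section
/- Let p be a prime number, let a be a real number with |a| < 2√p (the Hasse bound), and let s ∈ ℂ. If 1 − a·p^{−(s+1/2)} + p^{−2s} = 0, then Re(s) = 0. (The poles of a good-reduction local factor lie on the imaginary axis.) -/
/-- The inverse local Euler factor at a prime of good reduction,
in analytic normalization: `f p a s = 1 - a·p^{-(s+1/2)} + p^{-2s}`,
where `p^z := exp (z · log p)`. -/
noncomputable def goodLocalFactorInv (p : ℕ) (a : ℝ) (s : ℂ) : ℂ :=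
  1 - (a : ℂ) * Complex.exp (-(s + 1/2) * (Real.log p : ℂ))
    + Complex.exp (-(2 * s) * (Real.log p : ℂ))

/-- The roots of `X² - cX + 1`, for real `|c| < 2`, lie on the unit circle. -/
theorem norm_eq_one_of_sq_sub_mul_add_one_eq_zero {c : ℝ} (hc : |c| < 2) {u : ℂ}
    (hu : u ^ 2 - c * u + 1 = 0) : ‖u‖ = 1 := by
  obtain ⟨hc₁, hc₂⟩ := abs_lt.mp hc
  have hre := congrArg Complex.re hu
  have him := congrArg Complex.im hu
  simp [pow_two] at hre him
  have him' : u.im * (2 * u.re - c) = 0 := by linarith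
  have hsq : u.re * u.re + u.im * u.im = 1 := by
    rcases mul_eq_zero.mp him' with h | h
    · rw [h] at hre
      nlinarith [sq_nonneg (2 * u.re - c)]
    · rw [← sub_eq_zero.mp h] at hre
      linarith
  rw [Complex.norm_def, Complex.normSq_apply, hsq, Real.sqrt_one]

/-- if `p` is prime, `|a| < 2√p` (Hasse bound), and
`1 - a·p^{-(s+1/2)} + p^{-2s} = 0`, then `Re s = 0`. -/
theorem good_reduction_poles_on_imaginary_axis
    (p : ℕ) (hp : p.Prime) (a : ℝ) (ha : |a| < 2 * Real.sqrt p)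
    (s : ℂ) (hs : goodLocalFactorInv p a s = 0) :
    s.re = 0 := by
  have hp₀ : (0 : ℝ) < p := by exact_mod_cast hp.pos
  have hlog : 0 < Real.log p := Real.log_pos (by exact_mod_cast hp.one_lt)
  have hsqrt : 0 < Real.sqrt p := Real.sqrt_pos.mpr hp₀
  have hc : |a / Real.sqrt p| < 2 := by
    rwa [abs_div, abs_of_pos hsqrt, div_lt_iff₀ hsqrt]
  have hexp : Complex.exp (-(1 / 2) * (Real.log p : ℂ)) = ((Real.sqrt p)⁻¹ : ℝ) := by
    rw [← Real.exp_log (inv_pos.mpr hsqrt), Real.log_inv, Real.log_sqrt hp₀.le,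
      Complex.ofReal_exp]
    push_cast
    ring_nf
  have hu : Complex.exp (-s * (Real.log p : ℂ)) ^ 2
      - ((a / Real.sqrt p : ℝ) : ℂ) * Complex.exp (-s * (Real.log p : ℂ)) + 1 = 0 := by
    have h₁ : Complex.exp (-(s + 1 / 2) * (Real.log p : ℂ))
        = Complex.exp (-s * (Real.log p : ℂ)) * ((Real.sqrt p)⁻¹ : ℝ) := by
      rw [← hexp, ← Complex.exp_add]
      ring_nf
    have h₂ : Complex.exp (-(2 * s) * (Real.log p : ℂ))
        = Complex.exp (-s * (Real.log p : ℂ)) ^ 2 := by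
      rw [← Complex.exp_nat_mul]
      push_cast
      ring_nf
    rw [goodLocalFactorInv, h₁, h₂] at hs
    rw [← hs, div_eq_mul_inv, Complex.ofReal_mul]
    ring
  have hnorm := norm_eq_one_of_sq_sub_mul_add_one_eq_zero hc hu
  rw [Complex.norm_exp, Real.exp_eq_one_iff, Complex.re_mul_ofReal, Complex.neg_re] at hnorm
  exact neg_eq_zero.mp ((mul_eq_zero.mp hnorm).resolve_right hlog.ne')
end

section
/- Let p be a prime, a a real number with |a| < 2√p, k ∈ ℤ, ε ∈ {−1,+1}, and let s⋆ = (2πi k)/log p + (1/log p)·Log((a + ε·i·√(4p − a²))/(2√p)). Then the function f(s) = 1 − a·p^{−(s+1/2)} + p^{−2s} is complex differentiable at s⋆, f'(s⋆) ≠ 0, and 1/f'(s⋆) = (1/(2 log p))·(1 − ε·i·a/√(4p − a²)). In particular the residue of 1/f at the simple zero s⋆ equals (1/(2 log p))·(1 − ε·i·a/√(4p − a²)). -/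
theorem hasDerivAt_goodLocalFactorInv (p : ℕ) (a : ℝ) (s : ℂ) :
    HasDerivAt (goodLocalFactorInv p a)
      ((Real.log p : ℂ) * (a * Complex.exp (-(s + 1/2) * (Real.log p : ℂ))
        - 2 * Complex.exp (-(2 * s) * (Real.log p : ℂ)))) s := by
  have h₁ : HasDerivAt (fun z : ℂ => -(z + 1/2) * (Real.log p : ℂ))
      (-1 * (Real.log p : ℂ)) s :=
    (((hasDerivAt_id s).add_const (1/2 : ℂ)).neg).mul_const _
  have h₂ : HasDerivAt (fun z : ℂ => -(2 * z) * (Real.log p : ℂ))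
      (-(2 * 1) * (Real.log p : ℂ)) s :=
    (((hasDerivAt_id s).const_mul (2 : ℂ)).neg).mul_const _
  have h := ((h₁.cexp.const_mul (a : ℂ)).const_sub 1).add h₂.cexp
  refine h.congr_deriv ?_
  ring

theorem exp_half_mul_log {x : ℝ} (hx : 0 < x) :
    Complex.exp (1/2 * (Real.log x : ℂ)) = (Real.sqrt x : ℂ) := by
  have h : (1/2 * (Real.log x : ℂ)) = ((Real.log (Real.sqrt x) : ℝ) : ℂ) := by
    rw [Real.log_sqrt hx.le]
    push_cast
    ring
  rw [h, ← Complex.ofReal_exp, Real.exp_log (Real.sqrt_pos.2 hx)]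

theorem exp_neg_mul_of_eq_log {L w s : ℂ} (hL : L ≠ 0) (hw : w ≠ 0) (k : ℤ)
    (hs : s = (2 * Real.pi * Complex.I * (k : ℂ)) / L + (1 / L) * Complex.log w) :
    Complex.exp (-s * L) = w⁻¹ := by
  have h : s * L = Complex.log w + k * (2 * Real.pi * Complex.I) := by
    rw [hs]
    field_simp
    ring
  rw [neg_mul, Complex.exp_neg, h, Complex.exp_add, Complex.exp_log hw,
    Complex.exp_int_mul_two_pi_mul_I, mul_one]


/-- at a zero
`s⋆ = 2πik/log p + (1/log p)·Log((a + ε i √(4p − a²))/(2√p))`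
of the good-reduction inverse local factor `f`, the function `f` is complex
differentiable, its derivative is nonzero, and the residue of `1/f` at the
simple zero `s⋆`, namely `1/f'(s⋆)`, equals
`(1/(2 log p))·(1 − ε·i·a/√(4p − a²))`. -/
theorem good_reduction_pole_residue
    (p : ℕ) (hp : p.Prime) (a : ℝ) (ha : |a| < 2 * Real.sqrt p)
    (k : ℤ) (ε : ℝ) (hε : ε = -1 ∨ ε = 1) (sstar : ℂ)
    (hsstar : sstar = (2 * Real.pi * Complex.I * (k : ℂ)) / (Real.log p : ℂ)
      + (1 / (Real.log p : ℂ)) *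
        Complex.log (((a : ℂ) + (ε : ℂ) * Complex.I * (Real.sqrt (4 * p - a ^ 2) : ℂ))
          / (2 * (Real.sqrt p : ℂ)))) :
    DifferentiableAt ℂ (goodLocalFactorInv p a) sstar ∧
    deriv (goodLocalFactorInv p a) sstar ≠ 0 ∧
    1 / deriv (goodLocalFactorInv p a) sstar =
      (1 / (2 * (Real.log p : ℂ))) *
        (1 - (ε : ℂ) * Complex.I * (a : ℂ) / (Real.sqrt (4 * p - a ^ 2) : ℂ)) := by
  have hp0 : (0 : ℝ) < p := by exact_mod_cast hp.pos
  have hL : (Real.log p : ℂ) ≠ 0 := by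
    exact_mod_cast (Real.log_pos (by exact_mod_cast hp.one_lt)).ne'
  have hdisc : 0 < 4 * (p : ℝ) - a ^ 2 := by
    have h := sq_lt_sq' (by linarith [abs_nonneg a, Real.sqrt_nonneg (p : ℝ)]) ha
    rw [sq_abs, mul_pow, Real.sq_sqrt hp0.le] at h
    linarith
  have hD : (Real.sqrt (4 * p - a ^ 2) : ℂ) ≠ 0 := by
    exact_mod_cast (Real.sqrt_pos.2 hdisc).ne'
  have hq : (Real.sqrt p : ℂ) ≠ 0 := by exact_mod_cast (Real.sqrt_pos.2 hp0).ne'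
  have hqsq : (Real.sqrt p : ℂ) ^ 2 = p := by exact_mod_cast Real.sq_sqrt hp0.le
  have hDsq : (Real.sqrt (4 * p - a ^ 2) : ℂ) ^ 2 = 4 * (Real.sqrt p : ℂ) ^ 2 - a ^ 2 := by
    rw [hqsq]
    exact_mod_cast Real.sq_sqrt hdisc.le
  have hεsq : (ε : ℂ) ^ 2 = 1 := by rcases hε with rfl | rfl <;> norm_num
  have hhalf := exp_half_mul_log hp0
  have hderiv := hasDerivAt_goodLocalFactorInv p a sstar
  have hexp := fun hw => exp_neg_mul_of_eq_log hL hw k hsstar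
  clear hsstar
  generalize (Real.sqrt (4 * p - a ^ 2) : ℂ) = D at *
  generalize (Real.sqrt p : ℂ) = q at *
  generalize (Real.log p : ℂ) = L at *
  generalize (ε : ℂ) = e at *
  have heI : (e * Complex.I) ^ 2 = -1 := by rw [mul_pow, hεsq, Complex.I_sq, one_mul]
  have hnorm : (a + e * Complex.I * D) * (a - e * Complex.I * D) = 4 * q ^ 2 := by
    linear_combination hDsq - D ^ 2 * heI
  have hne : (a + e * Complex.I * D) * (a - e * Complex.I * D) ≠ 0 := by
    rw [hnorm]
    exact mul_ne_zero (by norm_num) (pow_ne_zero 2 hq)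
  have hv : Complex.exp (-sstar * L) = (a - e * Complex.I * D) / (2 * q) := by
    rw [hexp (div_ne_zero (left_ne_zero_of_mul hne) (mul_ne_zero two_ne_zero hq)), inv_div,
      div_eq_div_iff (left_ne_zero_of_mul hne) (mul_ne_zero two_ne_zero hq)]
    linear_combination -hnorm
  have hshift : Complex.exp (-(sstar + 1/2) * L) = (a - e * Complex.I * D) / (2 * q) / q := by
    rw [← hv, ← hhalf, ← Complex.exp_sub]
    ring_nf
  have hsq : Complex.exp (-(2 * sstar) * L) = ((a - e * Complex.I * D) / (2 * q)) ^ 2 := by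
    rw [← hv, ← Complex.exp_nat_mul]
    push_cast
    ring_nf
  have hmul : deriv (goodLocalFactorInv p a) sstar *
      ((1 / (2 * L)) * (1 - e * Complex.I * a / D)) = 1 := by
    rw [hderiv.deriv, hshift, hsq]
    field_simp
    linear_combination D * hDsq - (D ^ 2 * (D - a * (e * Complex.I)) + D * a ^ 2) * heI
  exact ⟨hderiv.differentiableAt, left_ne_zero_of_mul_eq_one hmul,
    by rw [one_div]; exact inv_eq_of_mul_eq_one_right hmul⟩
end

section
/- Let p and q be distinct prime numbers, and let a, b be real numbers with |a| < 2√p and |b| < 2√q. Then the set { s ∈ ℂ : 1 − a·p^{−(s+1/2)} + p^{−2s} = 0 and 1 − b·q^{−(s+1/2)} + q^{−2s} = 0 } is finite and has at most four elements. (Two distinct good-reduction local factors can have at most four common poles.) -/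
/-- A monic quadratic with constant term `1` has at most two roots. -/
theorem exists_finset_roots_one_sub_mul_add_sq (c : ℂ) :
    ∃ T : Finset ℂ, T.card ≤ 2 ∧ ∀ x : ℂ, 1 - c * x + x ^ 2 = 0 → x ∈ T := by
  classical
  by_cases h : ∃ u : ℂ, 1 - c * u + u ^ 2 = 0
  · obtain ⟨u, hu⟩ := h
    refine ⟨{u, c - u}, Finset.card_le_two, fun x hx => ?_⟩
    have hprod : (x - u) * (x - (c - u)) = 0 := by linear_combination hx - hu
    rcases mul_eq_zero.mp hprod with h | h
    · simp [sub_eq_zero.mp h]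
    · simp [sub_eq_zero.mp h]
  · exact ⟨∅, by simp, fun x hx => (h ⟨x, hx⟩).elim⟩

theorem goodLocalFactorInv_eq_quadratic (p : ℕ) (a : ℝ) (s : ℂ) :
    goodLocalFactorInv p a s =
      1 - (a * Complex.exp (-(1 / 2) * (Real.log p : ℂ))) * Complex.exp (-s * (Real.log p : ℂ))
        + Complex.exp (-s * (Real.log p : ℂ)) ^ 2 := by
  rw [goodLocalFactorInv, mul_assoc, ← Complex.exp_add, ← Complex.exp_nat_mul]
  have h₁ : -(s + 1 / 2) * (Real.log p : ℂ) = -(1 / 2) * Real.log p + -s * Real.log p := by ring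
  have h₂ : -(2 * s) * (Real.log p : ℂ) = (2 : ℕ) * (-s * Real.log p) := by push_cast; ring
  rw [h₁, h₂]

/-- The logarithms of distinct primes are linearly independent over `ℤ`. -/
theorem eq_zero_of_mul_log_prime_eq {p q : ℕ} (hp : p.Prime) (hq : q.Prime) (hpq : p ≠ q)
    {m n : ℤ} (h : (n : ℝ) * Real.log p = m * Real.log q) : m = 0 := by
  have hlp : 0 < Real.log p := Real.log_pos (by exact_mod_cast hp.one_lt)
  have hlq : 0 < Real.log q := Real.log_pos (by exact_mod_cast hq.one_lt)
  by_contra hm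
  have habs : (n.natAbs : ℝ) * Real.log p = m.natAbs * Real.log q := by
    have := congrArg abs h
    rw [abs_mul, abs_mul, abs_of_pos hlp, abs_of_pos hlq] at this
    simpa [Nat.cast_natAbs] using this
  rw [← Real.log_pow, ← Real.log_pow] at habs
  have hpow : p ^ n.natAbs = q ^ m.natAbs := by
    have hp0 : (0 : ℝ) < p := by exact_mod_cast hp.pos
    have hq0 : (0 : ℝ) < q := by exact_mod_cast hq.pos
    exact_mod_cast Real.log_injOn_pos (Set.mem_Ioi.mpr (pow_pos hp0 _))
      (Set.mem_Ioi.mpr (pow_pos hq0 _)) habs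
  have hdvd : q ∣ p ^ n.natAbs := hpow ▸ dvd_pow_self q (Int.natAbs_ne_zero.mpr hm)
  exact hpq ((Nat.prime_dvd_prime_iff_eq hq hp).mp (hq.dvd_of_dvd_pow hdvd)).symm

/-- For distinct primes `p` and `q`, the pair `(p^{-s}, q^{-s})` determines `s`. -/
theorem injective_exp_neg_mul_log_prime {p q : ℕ} (hp : p.Prime) (hq : q.Prime) (hpq : p ≠ q) :
    Function.Injective fun s : ℂ =>
      (Complex.exp (-s * (Real.log p : ℂ)), Complex.exp (-s * (Real.log q : ℂ))) := by
  intro s t hst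
  obtain ⟨h₁, h₂⟩ := Prod.mk.inj hst
  obtain ⟨m, hm⟩ := Complex.exp_eq_exp_iff_exists_int.mp h₁
  obtain ⟨n, hn⟩ := Complex.exp_eq_exp_iff_exists_int.mp h₂
  have hlp : (Real.log p : ℂ) ≠ 0 :=
    Complex.ofReal_ne_zero.mpr (Real.log_pos (by exact_mod_cast hp.one_lt)).ne'
  have key : (n : ℝ) * Real.log p = m * Real.log q := by
    have : ((n : ℂ) * Real.log p) = m * Real.log q := by
      apply mul_right_cancel₀ Complex.two_pi_I_ne_zero
      linear_combination (Real.log q : ℂ) * hm - (Real.log p : ℂ) * hn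
    exact_mod_cast this
  have hm0 := eq_zero_of_mul_log_prime_eq hp hq hpq key
  apply mul_right_cancel₀ hlp
  rw [hm0, Int.cast_zero] at hm
  linear_combination -hm

/-- two distinct good-reduction local factors can share at most
four common poles: for distinct primes `p ≠ q` and Hasse-bounded `a`, `b`, the
set of common zeros of the two inverse local factors is finite, of cardinality
at most `4`. -/
theorem good_reduction_common_poles
    (p q : ℕ) (hp : p.Prime) (hq : q.Prime) (hpq : p ≠ q)
    (a b : ℝ) (ha : |a| < 2 * Real.sqrt p) (hb : |b| < 2 * Real.sqrt q) :
    {s : ℂ | goodLocalFactorInv p a s = 0 ∧ goodLocalFactorInv q b s = 0}.Finite ∧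
    {s : ℂ | goodLocalFactorInv p a s = 0 ∧ goodLocalFactorInv q b s = 0}.ncard ≤ 4 := by
  obtain ⟨T, hT, hTmem⟩ := exists_finset_roots_one_sub_mul_add_sq
    (a * Complex.exp (-(1 / 2) * (Real.log p : ℂ)))
  obtain ⟨U, hU, hUmem⟩ := exists_finset_roots_one_sub_mul_add_sq
    (b * Complex.exp (-(1 / 2) * (Real.log q : ℂ)))
  have hinj := injective_exp_neg_mul_log_prime hp hq hpq
  have hmaps : Set.MapsTo (fun s : ℂ =>
      (Complex.exp (-s * (Real.log p : ℂ)), Complex.exp (-s * (Real.log q : ℂ))))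
      {s : ℂ | goodLocalFactorInv p a s = 0 ∧ goodLocalFactorInv q b s = 0}
      (T ×ˢ U : Finset (ℂ × ℂ)) := by
    rintro s ⟨h₁, h₂⟩
    rw [goodLocalFactorInv_eq_quadratic] at h₁ h₂
    exact Finset.mem_coe.mpr (Finset.mem_product.mpr ⟨hTmem _ h₁, hUmem _ h₂⟩)
  refine ⟨Set.Finite.of_injOn hmaps hinj.injOn (Finset.finite_toSet _), ?_⟩
  calc _ ≤ ((T ×ˢ U : Finset (ℂ × ℂ)) : Set (ℂ × ℂ)).ncard :=
        Set.ncard_le_ncard_of_injOn _ hmaps hinj.injOn (Finset.finite_toSet _)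
    _ = T.card * U.card := by rw [Set.ncard_coe_finset, Finset.card_product]
    _ ≤ 2 * 2 := Nat.mul_le_mul hT hU
end

section
/- Let C > 0 be a real number, n ≥ 1 an integer, s₀ ∈ ℂ, and let σ be a real number with σ > Re(s₀) and σ > −1/2. Then the integral (1/(2π)) ∫_{−∞}^{∞} g(σ + it)·n^{−(σ+it)−1/2} / (σ + it − s₀) dt, where g(s) = C^{s/2}·2·(2π)^{−(s+1/2)}·Γ(s+1/2), converges absolutely and equals 2·C^{s₀/2}·(2πn)^{−s₀−1/2} · Γ(s₀ + 1/2, 2πn/√C), where Γ(z, a) = ∫_a^∞ t^{z−1} e^{−t} dt is the upper incomplete Gamma function. -/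
open MeasureTheory

/-- The Archimedean local factor in analytic normalization:
`g C s = C^{s/2} · 2 · (2π)^{−(s+1/2)} · Γ(s+1/2)`, where powers of positive
reals by complex exponents are defined via `exp` and the real logarithm. -/
noncomputable def archLocalFactor (C : ℝ) (s : ℂ) : ℂ :=
  Complex.exp ((s / 2) * (Real.log C : ℂ)) * 2 *
    Complex.exp (-(s + 1/2) * (Real.log (2 * Real.pi) : ℂ)) *
    Complex.Gamma (s + 1/2)

/-- The upper incomplete Gamma function `Γ(z, a) = ∫_a^∞ t^{z−1} e^{−t} dt`,
with `t^{z−1} := exp((z−1)·log t)` for `t > 0`. -/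
noncomputable def upperIncGamma (z : ℂ) (a : ℝ) : ℂ :=
  ∫ t in Set.Ioi a, Complex.exp ((z - 1) * (Real.log t : ℂ)) * (Real.exp (-t) : ℂ)

theorem Complex.norm_Gamma_le_Gamma_re {s : ℂ} (hs : 0 < s.re) :
    ‖Complex.Gamma s‖ ≤ Real.Gamma s.re := by
  rw [Complex.Gamma_eq_integral hs, Real.Gamma_eq_integral hs, Complex.GammaIntegral]
  refine (norm_integral_le_integral_norm _).trans_eq ?_
  refine setIntegral_congr_fun measurableSet_Ioi fun x hx => ?_
  simp only [norm_mul, Complex.norm_cpow_eq_rpow_re_of_pos (Set.mem_Ioi.mp hx),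
    Complex.norm_of_nonneg (Real.exp_pos _).le, Complex.sub_re, Complex.one_re]

theorem Complex.continuous_Gamma_vertical {c : ℝ} (hc : 0 < c) :
    Continuous fun t : ℝ => Complex.Gamma ((c : ℂ) + (t : ℂ) * Complex.I) := by
  refine continuous_iff_continuousAt.mpr fun t => ?_
  have h : ContinuousAt Complex.Gamma ((c : ℂ) + (t : ℂ) * Complex.I) := by
    refine (Complex.differentiableAt_Gamma _ fun m hm => ?_).continuousAt
    have := congrArg Complex.re hm
    simp only [Complex.add_re, Complex.ofReal_re, Complex.mul_re, Complex.I_re, mul_zero,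
      Complex.ofReal_im, Complex.I_im, mul_one, sub_self, add_zero, Complex.neg_re,
      Complex.natCast_re] at this
    linarith [m.cast_nonneg (α := ℝ)]
  exact ContinuousAt.comp (f := fun t : ℝ => (c : ℂ) + (t : ℂ) * Complex.I) h (by fun_prop)

theorem Complex.integrable_Gamma_vertical {c : ℝ} (hc : 0 < c) :
    Integrable fun t : ℝ => Complex.Gamma ((c : ℂ) + (t : ℂ) * Complex.I) := by
  have hm : 0 < min 1 (c ^ 2) := lt_min one_pos (by positivity)
  refine (integrable_inv_one_add_sq.const_mul (Real.Gamma (c + 2) / min 1 (c ^ 2))).mono'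
    (Complex.continuous_Gamma_vertical hc).aestronglyMeasurable (ae_of_all _ fun t => ?_)
  set w : ℂ := (c : ℂ) + (t : ℂ) * Complex.I with hw
  have hre : w.re = c := by simp [hw]
  have him : w.im = t := by simp [hw]
  have hw0 : w ≠ 0 := fun h => by rw [h] at hre; simp at hre; linarith
  have hw1 : w + 1 ≠ 0 := fun h => by
    have := congrArg Complex.re h
    simp [hre] at this
    linarith
  have hrec : Complex.Gamma (w + 1 + 1) = (w + 1) * (w * Complex.Gamma w) := by
    rw [Complex.Gamma_add_one _ hw1, Complex.Gamma_add_one _ hw0]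
  have hle := Complex.norm_Gamma_le_Gamma_re (s := w + 1 + 1) (by simp [hre]; linarith)
  have hre2 : (w + 1 + 1).re = c + 2 := by simp [hre]; ring
  rw [hrec, hre2, norm_mul, norm_mul] at hle
  have h1 : ‖w‖ ≤ ‖w + 1‖ := by
    rw [← sq_le_sq₀ (norm_nonneg _) (norm_nonneg _), Complex.sq_norm, Complex.sq_norm,
      Complex.normSq_apply, Complex.normSq_apply]
    simp only [Complex.add_re, Complex.add_im, Complex.one_re, Complex.one_im, hre]
    nlinarith
  have h2 : ‖w‖ ^ 2 = c ^ 2 + t ^ 2 := by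
    rw [Complex.sq_norm, Complex.normSq_apply, hre, him]; ring
  have h3 : min 1 (c ^ 2) * (1 + t ^ 2) ≤ ‖w‖ ^ 2 := by
    rw [h2]
    nlinarith [min_le_left 1 (c ^ 2), min_le_right 1 (c ^ 2), sq_nonneg t]
  rw [← div_eq_mul_inv, div_div, le_div_iff₀ (by positivity)]
  calc ‖Complex.Gamma w‖ * (min 1 (c ^ 2) * (1 + t ^ 2))
      ≤ ‖Complex.Gamma w‖ * ‖w‖ ^ 2 := by gcongr
    _ = ‖w‖ * (‖w‖ * ‖Complex.Gamma w‖) := by ring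
    _ ≤ ‖w + 1‖ * (‖w‖ * ‖Complex.Gamma w‖) := by gcongr
    _ ≤ _ := hle

/-- The Cahen–Mellin integral. -/
theorem Complex.integral_cpow_mul_Gamma_vertical {c x : ℝ} (hc : 0 < c) (hx : 0 < x) :
    ∫ t : ℝ, (x : ℂ) ^ (-((c : ℂ) + (t : ℂ) * Complex.I)) *
        Complex.Gamma ((c : ℂ) + (t : ℂ) * Complex.I) =
      2 * (Real.pi : ℂ) * (Real.exp (-x) : ℂ) := by
  have hmel (s : ℂ) (hs : 0 < s.re) :
      mellin (fun x : ℝ => (Real.exp (-x) : ℂ)) s = Complex.Gamma s := by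
    rw [Complex.Gamma_eq_integral hs, Complex.GammaIntegral_eq_mellin]
  have hmel' (t : ℝ) : mellin (fun x : ℝ => (Real.exp (-x) : ℂ))
      ((c : ℂ) + (t : ℂ) * Complex.I) = Complex.Gamma ((c : ℂ) + (t : ℂ) * Complex.I) :=
    hmel _ (by simpa using hc)
  have h := mellinInv_mellin_eq c (fun x : ℝ => (Real.exp (-x) : ℂ)) hx
    (by
      have := Complex.GammaIntegral_convergent (s := c) (by simpa using hc)
      simpa only [MellinConvergent, smul_eq_mul, mul_comm] using this)
    (by
      simpa only [Complex.VerticalIntegrable, hmel'] using Complex.integrable_Gamma_vertical hc)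
    (by fun_prop)
  simp only [mellinInv, hmel', smul_eq_mul, Complex.real_smul] at h
  have hpi : (Real.pi : ℂ) ≠ 0 := by exact_mod_cast Real.pi_ne_zero
  rw [← h, ← mul_assoc]
  push_cast
  rw [mul_one_div_cancel (mul_ne_zero two_ne_zero hpi), one_mul]

theorem Complex.integrable_cpow_mul_Gamma_vertical {c x : ℝ} (hc : 0 < c) (hx : 0 < x) :
    Integrable fun t : ℝ => (x : ℂ) ^ (-((c : ℂ) + (t : ℂ) * Complex.I)) *
        Complex.Gamma ((c : ℂ) + (t : ℂ) * Complex.I) := by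
  refine (Complex.integrable_Gamma_vertical hc).bdd_mul (c := x ^ (-c)) ?_ (ae_of_all _ fun t => ?_)
  · exact (Measurable.aestronglyMeasurable (by fun_prop))
  · rw [Complex.norm_cpow_eq_rpow_re_of_pos hx]
    simp

theorem Complex.integral_Ioi_one_cpow_mul_exp_neg_mul {a : ℝ} (ha : 0 < a) (z : ℂ) :
    ∫ u in Set.Ioi (1 : ℝ), (u : ℂ) ^ (z - 1) * (Real.exp (-(a * u)) : ℂ) =
      (a : ℂ) ^ (-z) * upperIncGamma z a := by
  have h := integral_comp_mul_left_Ioi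
    (fun t : ℝ => (t : ℂ) ^ (z - 1) * (Real.exp (-t) : ℂ)) 1 ha
  have ha' : (a : ℂ) ≠ 0 := by exact_mod_cast ha.ne'
  have hG : upperIncGamma z a =
      ∫ t in Set.Ioi a, (t : ℂ) ^ (z - 1) * (Real.exp (-t) : ℂ) := by
    refine setIntegral_congr_fun measurableSet_Ioi fun t ht => ?_
    have ht0 : 0 < t := ha.trans ht
    simp only [Complex.cpow_def_of_ne_zero (Complex.ofReal_ne_zero.mpr ht0.ne'),
      Complex.ofReal_log ht0.le, mul_comm]
  rw [mul_one, ← hG] at h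
  have h2 : ∫ u in Set.Ioi (1 : ℝ), ((a * u : ℝ) : ℂ) ^ (z - 1) * (Real.exp (-(a * u)) : ℂ) =
      (a : ℂ) ^ (z - 1) *
        ∫ u in Set.Ioi (1 : ℝ), (u : ℂ) ^ (z - 1) * (Real.exp (-(a * u)) : ℂ) := by
    rw [← integral_const_mul]
    refine setIntegral_congr_fun measurableSet_Ioi fun u hu => ?_
    have hu0 : (0 : ℝ) ≤ u := zero_le_one.trans (le_of_lt hu)
    simp only [Complex.ofReal_mul a u, Complex.mul_cpow_ofReal_nonneg ha.le hu0, mul_assoc]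
  rw [h2] at h
  have h3 : (a : ℂ) ^ (z - 1) ≠ 0 := by simp [Complex.cpow_eq_zero_iff, ha']
  apply mul_left_cancel₀ h3
  rw [h, ← mul_assoc, ← Complex.cpow_add _ _ ha', show z - 1 + -z = -1 by ring,
    Complex.cpow_neg_one, Complex.real_smul, Complex.ofReal_inv]

theorem Complex.integrable_cpow_mul_Gamma_div_vertical {c a : ℝ} (hc : 0 < c) (ha : 0 < a)
    {z : ℂ} (hz : z.re < c) :
    Integrable fun t : ℝ => (a : ℂ) ^ (-((c : ℂ) + (t : ℂ) * Complex.I)) *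
        Complex.Gamma ((c : ℂ) + (t : ℂ) * Complex.I) /
        ((c : ℂ) + (t : ℂ) * Complex.I - z) := by
  simp only [div_eq_mul_inv]
  refine (Complex.integrable_cpow_mul_Gamma_vertical hc ha).mul_bdd (c := (c - z.re)⁻¹)
    (Measurable.aestronglyMeasurable (by fun_prop)) (ae_of_all _ fun t => ?_)
  rw [norm_inv]
  refine inv_anti₀ (by linarith) ?_
  simpa using Complex.re_le_norm ((c : ℂ) + (t : ℂ) * Complex.I - z)

theorem Complex.integral_cpow_mul_Gamma_div_vertical {c a : ℝ} (hc : 0 < c) (ha : 0 < a)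
    {z : ℂ} (hz : z.re < c) :
    ∫ t : ℝ, (a : ℂ) ^ (-((c : ℂ) + (t : ℂ) * Complex.I)) *
        Complex.Gamma ((c : ℂ) + (t : ℂ) * Complex.I) /
        ((c : ℂ) + (t : ℂ) * Complex.I - z) =
      2 * (Real.pi : ℂ) * ((a : ℂ) ^ (-z) * upperIncGamma z a) := by
  set G : ℝ → ℂ := fun t => (a : ℂ) ^ (-((c : ℂ) + (t : ℂ) * Complex.I)) *
    Complex.Gamma ((c : ℂ) + (t : ℂ) * Complex.I) with hG
  have hGi : Integrable G := Complex.integrable_cpow_mul_Gamma_vertical hc ha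
  have hinner (t : ℝ) : ∫ u in Set.Ioi (1 : ℝ),
      (u : ℂ) ^ (z - 1 - ((c : ℂ) + (t : ℂ) * Complex.I)) =
        ((c : ℂ) + (t : ℂ) * Complex.I - z)⁻¹ := by
    rw [integral_Ioi_cpow_of_lt (by simp; linarith) one_pos, Complex.ofReal_one,
      Complex.one_cpow, ← one_div, neg_div, ← div_neg]
    ring
  have hprod : Integrable (Function.uncurry fun (t u : ℝ) =>
      G t * (u : ℂ) ^ (z - 1 - ((c : ℂ) + (t : ℂ) * Complex.I)))
      (volume.prod (volume.restrict (Set.Ioi (1 : ℝ)))) := by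
    have hH : Integrable (fun u : ℝ => u ^ (z.re - 1 - c)) (volume.restrict (Set.Ioi (1 : ℝ))) :=
      integrableOn_Ioi_rpow_of_lt (by linarith) one_pos
    refine (hGi.norm.mul_prod hH).mono' (Measurable.aestronglyMeasurable ?_) ?_
    · have hGm : Measurable G := by
        have := (Complex.continuous_Gamma_vertical hc).measurable
        fun_prop
      simp only [Function.uncurry_def]
      fun_prop
    · have hmem : ∀ᵐ p : ℝ × ℝ ∂(volume.prod (volume.restrict (Set.Ioi (1 : ℝ)))), 1 < p.2 :=
        Measure.quasiMeasurePreserving_snd.ae (ae_restrict_mem measurableSet_Ioi)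
      filter_upwards [hmem] with p hp
      simp only [Function.uncurry_def, norm_mul,
        Complex.norm_cpow_eq_rpow_re_of_pos (one_pos.trans hp)]
      simp
  calc ∫ t : ℝ, G t / ((c : ℂ) + (t : ℂ) * Complex.I - z)
      = ∫ t : ℝ, ∫ u in Set.Ioi (1 : ℝ),
          G t * (u : ℂ) ^ (z - 1 - ((c : ℂ) + (t : ℂ) * Complex.I)) := by
        simp only [integral_const_mul, hinner, div_eq_mul_inv]
    _ = ∫ u in Set.Ioi (1 : ℝ), ∫ t : ℝ,
          G t * (u : ℂ) ^ (z - 1 - ((c : ℂ) + (t : ℂ) * Complex.I)) :=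
        integral_integral_swap hprod
    _ = ∫ u in Set.Ioi (1 : ℝ), 2 * (Real.pi : ℂ) *
          ((u : ℂ) ^ (z - 1) * (Real.exp (-(a * u)) : ℂ)) := by
        refine setIntegral_congr_fun measurableSet_Ioi fun u hu => ?_
        have hu0 : (0 : ℝ) < u := one_pos.trans hu
        have h := Complex.integral_cpow_mul_Gamma_vertical hc (mul_pos ha hu0)
        rw [mul_left_comm, ← h, ← integral_const_mul]
        refine integral_congr_ae (ae_of_all _ fun t => ?_)
        simp only [hG, Complex.ofReal_mul, Complex.mul_cpow_ofReal_nonneg ha.le hu0.le]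
        rw [sub_eq_add_neg, Complex.cpow_add _ _ (Complex.ofReal_ne_zero.mpr hu0.ne')]
        ring
    _ = _ := by
        rw [integral_const_mul, Complex.integral_Ioi_one_cpow_mul_exp_neg_mul ha]

theorem archLocalFactor_mul_exp_eq {C : ℝ} (hC : 0 < C) {n : ℕ} (hn : 1 ≤ n) (s : ℂ) :
    archLocalFactor C s * Complex.exp (-(s + 1/2) * (Real.log n : ℂ)) =
      2 * Complex.exp (-(1/4) * (Real.log C : ℂ)) *
        (((2 * Real.pi * n / Real.sqrt C : ℝ) : ℂ) ^ (-(s + 1/2)) * Complex.Gamma (s + 1/2)) := by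
  have hn0 : (0 : ℝ) < n := by exact_mod_cast hn
  have hsq : 0 < Real.sqrt C := Real.sqrt_pos.mpr hC
  have ha : 0 < 2 * Real.pi * n / Real.sqrt C := by positivity
  rw [Complex.cpow_def_of_ne_zero (Complex.ofReal_ne_zero.mpr ha.ne'), ← Complex.ofReal_log ha.le,
    Real.log_div (by positivity) hsq.ne', Real.log_mul (by positivity) hn0.ne',
    Real.log_sqrt hC.le, archLocalFactor]
  have hexp : Complex.exp (s / 2 * (Real.log C : ℂ)) *
      Complex.exp (-(s + 1/2) * (Real.log (2 * Real.pi) : ℂ)) *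
      Complex.exp (-(s + 1/2) * (Real.log n : ℂ)) =
      Complex.exp (-(1/4) * (Real.log C : ℂ)) *
      Complex.exp (((Real.log (2 * Real.pi) + Real.log n - Real.log C / 2 : ℝ) : ℂ) *
        -(s + 1/2)) := by
    simp only [← Complex.exp_add]
    congr 1
    push_cast
    ring
  linear_combination 2 * Complex.Gamma (s + 1/2) * hexp

/-- for `C > 0`, `n ≥ 1`, `s₀ ∈ ℂ`, and real `σ > Re s₀`,
`σ > −1/2`, the integral
`(1/2π) ∫_{−∞}^{∞} g(σ+it)·n^{−(σ+it)−1/2}/(σ+it−s₀) dt` converges absolutely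
and equals `2·C^{s₀/2}·(2πn)^{−s₀−1/2}·Γ(s₀ + 1/2, 2πn/√C)`. -/
theorem vertical_line_integral_eq_upper_incomplete_Gamma
    (C : ℝ) (hC : 0 < C) (n : ℕ) (hn : 1 ≤ n) (s₀ : ℂ) (σ : ℝ)
    (hσ₁ : s₀.re < σ) (hσ₂ : -1/2 < σ) :
    Integrable (fun t : ℝ =>
      archLocalFactor C ((σ : ℂ) + (t : ℂ) * Complex.I) *
        Complex.exp (-(((σ : ℂ) + (t : ℂ) * Complex.I) + 1/2) * (Real.log n : ℂ)) /
        ((σ : ℂ) + (t : ℂ) * Complex.I - s₀)) ∧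
    (1 / (2 * (Real.pi : ℂ))) *
      (∫ t : ℝ,
        archLocalFactor C ((σ : ℂ) + (t : ℂ) * Complex.I) *
          Complex.exp (-(((σ : ℂ) + (t : ℂ) * Complex.I) + 1/2) * (Real.log n : ℂ)) /
          ((σ : ℂ) + (t : ℂ) * Complex.I - s₀)) =
      2 * Complex.exp ((s₀ / 2) * (Real.log C : ℂ)) *
        Complex.exp (-(s₀ + 1/2) * (Real.log (2 * Real.pi * n) : ℂ)) *
        upperIncGamma (s₀ + 1/2) (2 * Real.pi * n / Real.sqrt C) := by
  have hn0 : (0 : ℝ) < n := by exact_mod_cast hn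
  have hsq : 0 < Real.sqrt C := Real.sqrt_pos.mpr hC
  have ha : 0 < 2 * Real.pi * n / Real.sqrt C := by positivity
  have hc : 0 < σ + 1/2 := by linarith
  have hz : (s₀ + 1/2).re < σ + 1/2 := by
    simp only [Complex.add_re, Complex.div_ofNat_re, Complex.one_re]
    linarith
  have hfun : (fun t : ℝ =>
      archLocalFactor C ((σ : ℂ) + (t : ℂ) * Complex.I) *
        Complex.exp (-(((σ : ℂ) + (t : ℂ) * Complex.I) + 1/2) * (Real.log n : ℂ)) /
        ((σ : ℂ) + (t : ℂ) * Complex.I - s₀)) = fun t : ℝ =>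
      2 * Complex.exp (-(1/4) * (Real.log C : ℂ)) *
        (((2 * Real.pi * n / Real.sqrt C : ℝ) : ℂ) ^
            (-(((σ + 1/2 : ℝ) : ℂ) + (t : ℂ) * Complex.I)) *
          Complex.Gamma (((σ + 1/2 : ℝ) : ℂ) + (t : ℂ) * Complex.I) /
          (((σ + 1/2 : ℝ) : ℂ) + (t : ℂ) * Complex.I - (s₀ + 1/2))) := by
    funext t
    have hw : ((σ + 1/2 : ℝ) : ℂ) + (t : ℂ) * Complex.I =
        (σ : ℂ) + (t : ℂ) * Complex.I + 1/2 := by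
      push_cast
      ring
    rw [archLocalFactor_mul_exp_eq hC hn, hw, add_sub_add_right_eq_sub, mul_div_assoc]
  rw [hfun]
  refine ⟨(Complex.integrable_cpow_mul_Gamma_div_vertical hc ha hz).const_mul _, ?_⟩
  rw [integral_const_mul, Complex.integral_cpow_mul_Gamma_div_vertical hc ha hz,
    Complex.cpow_def_of_ne_zero (Complex.ofReal_ne_zero.mpr ha.ne'), ← Complex.ofReal_log ha.le,
    Real.log_div (by positivity) hsq.ne', Real.log_sqrt hC.le]
  have hexp : Complex.exp (-(1/4) * (Real.log C : ℂ)) *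
      Complex.exp (((Real.log (2 * Real.pi * n) - Real.log C / 2 : ℝ) : ℂ) * -(s₀ + 1/2)) =
      Complex.exp ((s₀ / 2) * (Real.log C : ℂ)) *
        Complex.exp (-(s₀ + 1/2) * (Real.log (2 * Real.pi * n) : ℂ)) := by
    simp only [← Complex.exp_add]
    congr 1
    push_cast
    ring
  have hpi : (Real.pi : ℂ) ≠ 0 := by exact_mod_cast Real.pi_ne_zero
  rw [mul_assoc 2 (Complex.exp (s₀ / 2 * _)), ← hexp]
  generalize upperIncGamma _ _ = G
  field_simp
end
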